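/- Fix n > 0 and suppose θ = θ_NE(1−p) > 0. Then liminf_{x→∞} P(B⁺_n(x)) ≥ θ, where B⁺_n(x) is the event that, in the dual lattice Z²ᵘ_d of the H-model with parameter p, there is a directed path from (x,1/2) to (1/2,y) for some y > 0 which lies entirely inside the dual NE quadrant and avoids the box Λ_n. -/

import Mathlib

open MeasureTheory ENNReal

namespace RandomOrientation

/-- One step of the base-`(p, 1-p)` expansion map on `[0,1)`. -/
noncomputable def expand (p x : ℝ) : ℝ := if x < p then x / p else (x - p) / (1 - p)

/-- The `n`-th digit of the Bernoulli(`p`) expansion of `x`: for `x` uniformly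
distributed on `[0,1)` the digits are i.i.d. `{true, false}`-valued with
`P(true) = p`. -/
noncomputable def bernDigit (p : ℝ) (n : ℕ) (x : ℝ) : Bool :=
  decide ((expand p)^[n] x < p)

/-- The product over the countable index set `I` of Bernoulli(`p`) measures on
`Bool` (`P(true) = p`), realized as the joint distribution of the digits of the
Bernoulli(`p`) expansion of a uniform random point of `[0,1)`. -/
noncomputable def bernoulliProduct (I : Type*) [Encodable I] (p : ℝ) :
    Measure (I → Bool) :=
  Measure.map (fun x i => bernDigit p (Encodable.encode i) x)
    (volume.restrict (Set.Ico (0 : ℝ) 1))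

/-- Edges of `ℤ²`: `(v, false)` is the horizontal edge from `v` to `v + (1,0)`,
`(v, true)` the vertical edge from `v` to `v + (0,1)`. -/
abbrev Edge : Type := (ℤ × ℤ) × Bool

/-- An orientation configuration of the edges of `ℤ²`. -/
abbrev Config : Type := Edge → Bool

def eSrc (e : Edge) : ℤ × ℤ := e.1

def eDst (e : Edge) : ℤ × ℤ := if e.2 then (e.1.1, e.1.2 + 1) else (e.1.1 + 1, e.1.2)

/-- The law of the random orientation with parameter `p`: each edge independently
carries the bit `true` with probability `p`. -/
noncomputable def mu (p : ℝ) : Measure Config := bernoulliProduct Edge p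

/-- The directed-edge relation of Grimmett's random-orientation model:
`ω e = true` means the edge `e` is oriented in the positive coordinate direction
(rightwards resp. upwards), `ω e = false` in the negative one. -/
def gStep (ω : Config) (u v : ℤ × ℤ) : Prop :=
  ∃ e : Edge, (eSrc e = u ∧ eDst e = v ∧ ω e = true) ∨ (eSrc e = v ∧ eDst e = u ∧ ω e = false)

/-- Squared euclidean norm on `ℤ²`. -/
def normSq (v : ℤ × ℤ) : ℤ := v.1 ^ 2 + v.2 ^ 2

/-- The directed-edge relation of the H-model: `ω e = true` means the edge `e` is
oriented away from the origin, i.e. towards its endpoint of larger euclidean norm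
(adjacent vertices of `ℤ²` never have equal norms). -/
def hStep (ω : Config) (u v : ℤ × ℤ) : Prop :=
  ∃ e : Edge, ((eSrc e = u ∧ eDst e = v) ∨ (eSrc e = v ∧ eDst e = u)) ∧
    ω e = decide (normSq u < normSq v)

/-- There is an infinite directed self-avoiding path starting at the origin,
all of whose vertices lie in `S`, for the directed-step relation `R`. -/
def percolates (R : ℤ × ℤ → ℤ × ℤ → Prop) (S : Set (ℤ × ℤ)) : Prop :=
  ∃ γ : ℕ → ℤ × ℤ, γ 0 = (0, 0) ∧ Function.Injective γ ∧
    (∀ n, R (γ n) (γ (n + 1))) ∧ ∀ n, γ n ∈ S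

/-- The (closed) North-East quadrant of `ℤ²`. -/
def NEquad : Set (ℤ × ℤ) := {v | 0 ≤ v.1 ∧ 0 ≤ v.2}

/-- `θ_H(p)`: percolation probability of the H-model with parameter `p`. -/
noncomputable def thetaH (p : ℝ) : ℝ≥0∞ := mu p {ω | percolates (hStep ω) Set.univ}

/-- `θ_NE(p)`: probability of an infinite directed self-avoiding path from the
origin staying in the North-East quadrant, in the random-orientation model. -/
noncomputable def thetaNE (p : ℝ) : ℝ≥0∞ := mu p {ω | percolates (gStep ω) NEquad}

/-- `θ_G(p)`: percolation probability of Grimmett's random-orientation model. -/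
noncomputable def thetaG (p : ℝ) : ℝ≥0∞ := mu p {ω | percolates (gStep ω) Set.univ}

/-- The primal edge `e` is oriented in the positive coordinate direction, for the
H-model configuration `ω` (`ω e = true` means oriented away from the origin). -/
def hPos (ω : Config) (e : Edge) : Prop := ω e = decide (normSq (eSrc e) < normSq (eDst e))

/-- Directed step relation of the dual lattice `ℤ²ᵘ_d`.  The coded dual vertex
`(a, b) : ℤ × ℤ` stands for the point `(a + 1/2, b + 1/2)`.  A dual edge is
oriented in the direction of the *absent* orientation of the primal edge it
crosses, rotated by `π/2`; the dual edge between `(a,b)` and `(a+1,b)` crosses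
the primal vertical edge `((a+1, b), true)`, and the dual edge between `(a,b)`
and `(a,b+1)` crosses the primal horizontal edge `((a, b+1), false)`. -/
def dualStep (ω : Config) (d d' : ℤ × ℤ) : Prop :=
  (d' = (d.1 + 1, d.2) ∧ hPos ω ((d.1 + 1, d.2), true)) ∨
  (d = (d'.1 + 1, d'.2) ∧ ¬hPos ω ((d'.1 + 1, d'.2), true)) ∨
  (d' = (d.1, d.2 + 1) ∧ ¬hPos ω ((d.1, d.2 + 1), false)) ∨
  (d = (d'.1, d'.2 + 1) ∧ hPos ω ((d'.1, d'.2 + 1), false))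

/-- The coded dual vertex `d` (i.e. the point `d + (1/2, 1/2)`) lies in the box
`Λ_m = [-m, m]²`. -/
def inBox (m : ℕ) (d : ℤ × ℤ) : Prop := -(m : ℤ) ≤ d.1 ∧ d.1 < m ∧ -(m : ℤ) ≤ d.2 ∧ d.2 < m

/-- The coded dual vertex lies in the (open) NE quadrant `x > 0, y > 0`. -/
def dualNE (d : ℤ × ℤ) : Prop := 0 ≤ d.1 ∧ 0 ≤ d.2

/-- The coded dual vertex lies in the NW quadrant `x < 0, y > 0`. -/
def dualNW (d : ℤ × ℤ) : Prop := d.1 < 0 ∧ 0 ≤ d.2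

/-- The coded dual vertex lies in the SW quadrant `x < 0, y < 0`. -/
def dualSW (d : ℤ × ℤ) : Prop := d.1 < 0 ∧ d.2 < 0

/-- The coded dual vertex lies in the SE quadrant `x > 0, y < 0`. -/
def dualSE (d : ℤ × ℤ) : Prop := 0 ≤ d.1 ∧ d.2 < 0

/-- `B⁺_n(x)` for `x = k + 1/2`: in the dual lattice `ℤ²ᵘ_d` of the H-model there
is a directed path from `(x, 1/2)` (coded `(k, 0)`) to `(1/2, y)` for some `y > 0`
(coded `(0, b)`, `b ≥ 0`), lying entirely inside the dual NE quadrant and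
avoiding the box `Λ_n`. -/
def BplusAvoid (n k : ℕ) (ω : Config) : Prop :=
  ∃ (γ : ℕ → ℤ × ℤ) (L : ℕ), γ 0 = ((k : ℤ), 0) ∧ (γ L).1 = 0 ∧
    (∀ i < L, dualStep ω (γ i) (γ (i + 1))) ∧
    ∀ i ≤ L, dualNE (γ i) ∧ ¬inBox n (γ i)

section ProductMeasure

open ProbabilityTheory

/-- The Bernoulli(`p`) law on `Bool`. -/
noncomputable def bern (p : ℝ) : Measure Bool :=
  ENNReal.ofReal p • Measure.dirac true + ENNReal.ofReal (1 - p) • Measure.dirac false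

lemma isProbabilityMeasure_bern {p : ℝ} (h0 : 0 ≤ p) (h1 : p ≤ 1) :
    IsProbabilityMeasure (bern p) := by
  constructor
  simp only [bern, Measure.coe_add, Measure.coe_smul, Pi.add_apply, Pi.smul_apply, measure_univ,
    smul_eq_mul, mul_one]
  rw [← ENNReal.ofReal_add h0 (by linarith)]
  simp

lemma bern_true (p : ℝ) : bern p {true} = ENNReal.ofReal p := by simp [bern]

lemma bern_false (p : ℝ) : bern p {false} = ENNReal.ofReal (1 - p) := by simp [bern]

lemma map_not_bern (p : ℝ) : (bern p).map (fun b => !b) = bern (1 - p) := by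
  have hm : Measurable (fun b : Bool => !b) := measurable_of_countable _
  rw [bern, Measure.map_add _ _ hm, Measure.map_smul, Measure.map_smul,
    Measure.map_dirac' hm, Measure.map_dirac' hm, add_comm]
  simp [bern]

lemma measurable_expand (p : ℝ) : Measurable (expand p) := by
  unfold expand
  exact Measurable.ite (measurableSet_lt measurable_id measurable_const) (by fun_prop) (by fun_prop)

lemma measurable_bernDigit (p : ℝ) (n : ℕ) : Measurable (bernDigit p n) := by
  refine measurable_to_bool ?_
  have : bernDigit p n ⁻¹' {true} = {x | (expand p)^[n] x < p} := by
    ext x; simp [bernDigit]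
  rw [this]
  exact measurableSet_lt ((measurable_expand p).iterate n) measurable_const

/-- The uniform law on `[0,1)`. -/
noncomputable abbrev unif : Measure ℝ := volume.restrict (Set.Ico (0 : ℝ) 1)

instance : IsProbabilityMeasure unif := ⟨by simp [unif]⟩

lemma unif_lt_inter_expand {p : ℝ} (h0 : 0 ≤ p) (h1 : p ≤ 1) {B : Set ℝ} (hB : MeasurableSet B) :
    unif ({x | x < p} ∩ expand p ⁻¹' B) = ENNReal.ofReal p * unif B := by
  have hlt : MeasurableSet {x : ℝ | x < p} := measurableSet_lt measurable_id measurable_const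
  rw [unif, Measure.restrict_apply (hlt.inter (measurable_expand p hB)),
    Measure.restrict_apply hB]
  rcases h0.eq_or_lt with rfl | hp
  · simp only [ENNReal.ofReal_zero, zero_mul]
    convert measure_empty (μ := volume) using 2
    ext x
    simp only [Set.mem_inter_iff, Set.mem_ofPred_eq, Set.mem_Ico, Set.mem_empty_iff_false, iff_false]
    rintro ⟨⟨h, -⟩, h', -⟩
    linarith
  · have : {x | x < p} ∩ expand p ⁻¹' B ∩ Set.Ico 0 1
        = (fun x => x * p⁻¹) ⁻¹' (B ∩ Set.Ico 0 1) := by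
      ext x
      simp only [Set.mem_inter_iff, Set.mem_ofPred_eq, Set.mem_preimage, Set.mem_Ico, expand,
        ← div_eq_mul_inv]
      rw [le_div_iff₀ hp, div_lt_one hp, zero_mul]
      constructor
      · rintro ⟨⟨h, hb⟩, h', -⟩
        rw [if_pos h] at hb
        exact ⟨hb, h', h⟩
      · rintro ⟨hb, h', h⟩
        rw [if_pos h]
        exact ⟨⟨h, hb⟩, h', by linarith⟩
    rw [this, Real.volume_preimage_mul_right (by positivity), inv_inv, abs_of_pos hp]

lemma unif_ge_inter_expand {p : ℝ} (h0 : 0 ≤ p) (h1 : p ≤ 1) {B : Set ℝ} (hB : MeasurableSet B) :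
    unif ({x | x < p}ᶜ ∩ expand p ⁻¹' B) = ENNReal.ofReal (1 - p) * unif B := by
  have hlt : MeasurableSet {x : ℝ | x < p} := measurableSet_lt measurable_id measurable_const
  rw [unif, Measure.restrict_apply (hlt.compl.inter (measurable_expand p hB)),
    Measure.restrict_apply hB]
  rcases h1.eq_or_lt with rfl | hp
  · simp only [sub_self, ENNReal.ofReal_zero, zero_mul]
    convert measure_empty (μ := volume) using 2
    ext x
    simp only [Set.mem_inter_iff, Set.mem_compl_iff, Set.mem_ofPred_eq, Set.mem_Ico,
      Set.mem_empty_iff_false, iff_false]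
    rintro ⟨⟨h, -⟩, -, h'⟩
    exact h h'
  · have hp' : 0 < 1 - p := by linarith
    have : {x | x < p}ᶜ ∩ expand p ⁻¹' B ∩ Set.Ico 0 1
        = (fun x => x + -p) ⁻¹' ((fun x => x * (1 - p)⁻¹) ⁻¹' (B ∩ Set.Ico 0 1)) := by
      ext x
      simp only [Set.mem_inter_iff, Set.mem_compl_iff, Set.mem_ofPred_eq, Set.mem_preimage,
        Set.mem_Ico, expand, ← div_eq_mul_inv, ← sub_eq_add_neg]
      rw [le_div_iff₀ hp', div_lt_one hp', zero_mul]
      constructor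
      · rintro ⟨⟨h, hb⟩, h', h''⟩
        rw [if_neg h] at hb
        exact ⟨hb, by linarith, by linarith⟩
      · rintro ⟨hb, h', h⟩
        have hx : ¬ x < p := by linarith
        rw [if_neg hx]
        exact ⟨⟨hx, hb⟩, by linarith, by linarith⟩
    rw [this, measure_preimage_add_right, Real.volume_preimage_mul_right (by positivity), inv_inv,
      abs_of_pos hp']

lemma unif_digit_inter_expand {p : ℝ} (h0 : 0 ≤ p) (h1 : p ≤ 1) (t : Set Bool) {B : Set ℝ}
    (hB : MeasurableSet B) :
    unif (bernDigit p 0 ⁻¹' t ∩ expand p ⁻¹' B) = bern p t * unif B := by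
  classical
  have hlt : MeasurableSet {x : ℝ | x < p} := measurableSet_lt measurable_id measurable_const
  rw [← measure_inter_add_sdiff _ hlt]
  have e1 : bernDigit p 0 ⁻¹' t ∩ expand p ⁻¹' B ∩ {x | x < p}
      = if true ∈ t then {x | x < p} ∩ expand p ⁻¹' B else ∅ := by
    ext x
    by_cases hx : x < p <;> by_cases ht : true ∈ t <;> simp [bernDigit, hx, ht]
  have e2 : (bernDigit p 0 ⁻¹' t ∩ expand p ⁻¹' B) \ {x | x < p}
      = if false ∈ t then {x | x < p}ᶜ ∩ expand p ⁻¹' B else ∅ := by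
    ext x
    by_cases hx : x < p <;> by_cases ht : false ∈ t <;> simp [bernDigit, hx, ht]
  have e3 : bern p t = (if true ∈ t then ENNReal.ofReal p else 0)
      + (if false ∈ t then ENNReal.ofReal (1 - p) else 0) := by
    simp [bern, Set.indicator]
  rw [e1, e2, e3, add_mul]
  congr 1
  · split_ifs
    · exact unif_lt_inter_expand h0 h1 hB
    · simp
  · split_ifs
    · exact unif_ge_inter_expand h0 h1 hB
    · simp

lemma unif_digits {p : ℝ} (h0 : 0 ≤ p) (h1 : p ≤ 1) (n : ℕ) (t : ℕ → Set Bool) :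
    unif {x | ∀ i < n, bernDigit p i x ∈ t i} = ∏ i ∈ Finset.range n, bern p (t i) := by
  induction n generalizing t with
  | zero => simp
  | succ n ih =>
    have hset : {x | ∀ i < n + 1, bernDigit p i x ∈ t i}
        = bernDigit p 0 ⁻¹' t 0 ∩ expand p ⁻¹' {x | ∀ i < n, bernDigit p i x ∈ t (i + 1)} := by
      ext x
      simp only [Set.mem_ofPred_eq, Set.mem_inter_iff, Set.mem_preimage]
      constructor
      · intro h
        exact ⟨h 0 (by omega), fun i hi => h (i + 1) (by omega)⟩
      · rintro ⟨h, h'⟩ i hi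
        cases i with
        | zero => exact h
        | succ i => exact h' i (by omega)
    have hm : MeasurableSet {x | ∀ i < n, bernDigit p i x ∈ t (i + 1)} := by
      simp only [Set.ofPred_forall]
      exact .iInter fun i => .iInter fun _ =>
        measurable_bernDigit p i (MeasurableSet.of_discrete (s := t (i + 1)))
    rw [hset, unif_digit_inter_expand h0 h1 _ hm, ih (fun i => t (i + 1)),
      Finset.prod_range_succ', mul_comm]

lemma map_digits_eq_infinitePi {p : ℝ} (h0 : 0 ≤ p) (h1 : p ≤ 1) :
    unif.map (fun x i => bernDigit p i x) = Measure.infinitePi (fun _ : ℕ => bern p) := by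
  have := isProbabilityMeasure_bern h0 h1
  have hmeas : Measurable (fun x i => bernDigit p i x) :=
    measurable_pi_lambda _ (measurable_bernDigit p)
  refine Measure.eq_infinitePi _ fun s t ht => ?_
  classical
  obtain ⟨n, hn⟩ := s.exists_nat_subset_range
  rw [Measure.map_apply hmeas (.pi s.countable_toSet fun _ _ => ht _)]
  have := unif_digits h0 h1 n (fun i => if i ∈ s then t i else Set.univ)
  have e : {x | ∀ i < n, bernDigit p i x ∈ (if i ∈ s then t i else Set.univ)}
      = (fun x i => bernDigit p i x) ⁻¹' (Set.pi s t) := by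
    ext x
    simp only [Set.mem_ofPred_eq, Set.mem_preimage, Set.mem_pi, SetLike.mem_coe]
    constructor
    · intro h i hi
      simpa [hi] using h i (Finset.mem_range.1 (hn hi))
    · intro h i _
      split_ifs with hi
      · exact h i hi
      · trivial
  rw [← e, this, ← Finset.prod_subset hn]
  · exact Finset.prod_congr rfl fun i hi => by simp [hi]
  · intro i _ hi
    rw [if_neg hi, measure_univ]

lemma mu_eq_infinitePi {p : ℝ} (h0 : 0 ≤ p) (h1 : p ≤ 1) :
    mu p = Measure.infinitePi (fun _ : Edge => bern p) := by
  have := isProbabilityMeasure_bern h0 h1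
  have hmeas : Measurable (fun x i => bernDigit p i x) :=
    measurable_pi_lambda _ (measurable_bernDigit p)
  rw [← Measure.map_infinitePi_infinitePi_of_inj (P := fun _ : ℕ => bern p)
    (Encodable.encode_injective (α := Edge)), ← map_digits_eq_infinitePi h0 h1,
    Measure.map_map (by fun_prop) hmeas]
  rfl

lemma isProbabilityMeasure_mu {p : ℝ} (h0 : 0 ≤ p) (h1 : p ≤ 1) : IsProbabilityMeasure (mu p) := by
  have := isProbabilityMeasure_bern h0 h1
  rw [mu_eq_infinitePi h0 h1]
  infer_instance

lemma map_reindex_mu {p : ℝ} (h0 : 0 ≤ p) (h1 : p ≤ 1) {σ : Edge → Edge}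
    (hσ : Function.Injective σ) : (mu p).map (fun ω e => ω (σ e)) = mu p := by
  have := isProbabilityMeasure_bern h0 h1
  rw [mu_eq_infinitePi h0 h1, Measure.map_infinitePi_infinitePi_of_inj hσ]

lemma map_not_reindex_mu {p : ℝ} (h0 : 0 ≤ p) (h1 : p ≤ 1) {σ : Edge → Edge}
    (hσ : Function.Injective σ) : (mu p).map (fun ω e => !ω (σ e)) = mu (1 - p) := by
  have := isProbabilityMeasure_bern h0 h1
  have hn : Measurable (fun b : Bool => !b) := measurable_of_countable _
  have hm : Measurable (fun (ω : Config) e => !ω e) :=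
    measurable_pi_lambda _ fun e => hn.comp (measurable_pi_apply e)
  have hr : Measurable (fun (ω : Config) e => ω (σ e)) := by fun_prop
  calc (mu p).map (fun ω e => !ω (σ e))
      = ((mu p).map (fun ω e => ω (σ e))).map (fun ω e => !ω e) := by
        rw [Measure.map_map hm hr]; rfl
    _ = (mu p).map (fun ω e => !ω e) := by rw [map_reindex_mu h0 h1 hσ]
    _ = mu (1 - p) := by
        rw [mu_eq_infinitePi h0 h1,
          Measure.infinitePi_map_pi (μ := fun _ : Edge => bern p) (f := fun _ b => !b)
            (fun _ => hn), mu_eq_infinitePi (by linarith) (by linarith), map_not_bern]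

lemma mu_pi {p : ℝ} (h0 : 0 ≤ p) (h1 : p ≤ 1) (s : Finset Edge) (b : Bool) :
    mu p {ω | ∀ e ∈ s, ω e = b} = bern p {b} ^ s.card := by
  have := isProbabilityMeasure_bern h0 h1
  rw [mu_eq_infinitePi h0 h1]
  have := Measure.infinitePi_pi (fun _ : Edge => bern p) (s := s) (t := fun _ => {b})
    (fun _ _ => MeasurableSet.singleton b)
  rw [Finset.prod_const] at this
  rw [← this]
  rfl

lemma ae_all_eq {p : ℝ} (h0 : 0 ≤ p) (h1 : p ≤ 1) {b : Bool} (hb : bern p {b} = 1) :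
    ∀ᵐ ω ∂mu p, ∀ e, ω e = b := by
  have := isProbabilityMeasure_mu h0 h1
  refine ae_all_iff.2 fun e => ?_
  have hm : MeasurableSet {ω : Config | ω e = b} :=
    measurableSet_eq_fun (measurable_pi_apply e) measurable_const
  refine (prob_compl_eq_zero_iff hm).2 ?_
  have := mu_pi h0 h1 {e} b
  simpa [hb] using this

/-- The σ-algebra generated by the edges in `D`. -/
abbrev edgeSigma (D : Set Edge) : MeasurableSpace Config :=
  ⨆ e ∈ D, MeasurableSpace.comap (fun ω : Config => ω e) inferInstance

lemma edgeSigma_mono {D D' : Set Edge} (h : D ⊆ D') : edgeSigma D ≤ edgeSigma D' :=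
  biSup_mono h

lemma edgeSigma_le (D : Set Edge) : edgeSigma D ≤ MeasurableSpace.pi :=
  iSup₂_le fun e _ => (measurable_pi_apply e).comap_le

lemma measurableSet_edgeSigma_eq {D : Set Edge} {e : Edge} (he : e ∈ D) (b : Bool) :
    MeasurableSet[edgeSigma D] {ω : Config | ω e = b} :=
  (le_iSup₂_of_le (f := fun e _ => MeasurableSpace.comap (fun ω : Config => ω e) inferInstance)
    e he le_rfl) _ ⟨{b}, MeasurableSet.singleton b, rfl⟩

lemma indep_edgeSigma {p : ℝ} (h0 : 0 ≤ p) (h1 : p ≤ 1) {D D' : Set Edge} (h : Disjoint D D') :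
    Indep (edgeSigma D) (edgeSigma D') (mu p) := by
  have := isProbabilityMeasure_bern h0 h1
  rw [mu_eq_infinitePi h0 h1]
  refine indep_iSup_of_disjoint (fun e => (measurable_pi_apply e).comap_le) ?_ h
  exact (iIndepFun_infinitePi (P := fun _ : Edge => bern p) (X := fun _ b => b)
    (fun _ => measurable_id)).iIndep

lemma mu_inter_of_disjoint {p : ℝ} (h0 : 0 ≤ p) (h1 : p ≤ 1) {D D' : Set Edge}
    (h : Disjoint D D') {E E' : Set Config} (hE : MeasurableSet[edgeSigma D] E)
    (hE' : MeasurableSet[edgeSigma D'] E') : mu p (E ∩ E') = mu p E * mu p E' :=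
  (Indep_iff _ _ _).1 (indep_edgeSigma h0 h1 h) E E' hE hE'

end ProductMeasure

section IndependentTrials

variable {p : ℝ}

lemma mu_iInter_compl_le (h0 : 0 ≤ p) (h1 : p ≤ 1) {D : ℕ → Set Edge}
    (hD : Pairwise fun i j => Disjoint (D i) (D j)) {E : ℕ → Set Config}
    (hE : ∀ i, MeasurableSet[edgeSigma (D i)] (E i)) {c : ℝ≥0∞} (hc : ∀ i, c ≤ mu p (E i))
    (M : ℕ) : mu p (⋂ i < M, (E i)ᶜ) ≤ (1 - c) ^ M := by
  have := isProbabilityMeasure_mu h0 h1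
  induction M with
  | zero => simp
  | succ M ih =>
    have hset : (⋂ i < M + 1, (E i)ᶜ) = (⋂ i < M, (E i)ᶜ) ∩ (E M)ᶜ := by
      ext ω
      simp only [Set.mem_iInter, Set.mem_inter_iff, Nat.lt_succ_iff_lt_or_eq, or_imp, forall_and,
        forall_eq]
    have hm : MeasurableSet[edgeSigma (⋃ i < M, D i)] (⋂ i < M, (E i)ᶜ) :=
      MeasurableSet.iInter fun i => MeasurableSet.iInter fun hi =>
        MeasurableSet.compl (edgeSigma_mono (Set.subset_iUnion₂ (s := fun i (_ : i < M) => D i) i hi) _ (hE i))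
    have hdisj : Disjoint (⋃ i < M, D i) (D M) := by
      simp only [Set.disjoint_iUnion_left]
      exact fun i hi => hD (Nat.ne_of_lt hi)
    rw [hset, mu_inter_of_disjoint h0 h1 hdisj hm (MeasurableSet.compl (hE M)), pow_succ,
      prob_compl_eq_one_sub (edgeSigma_le _ _ (hE M))]
    gcongr
    exact hc M

lemma ae_exists_of_independent (h0 : 0 ≤ p) (h1 : p ≤ 1) {D : ℕ → Set Edge}
    (hD : Pairwise fun i j => Disjoint (D i) (D j)) {E : ℕ → Set Config}
    (hE : ∀ i, MeasurableSet[edgeSigma (D i)] (E i)) {c : ℝ≥0∞} (hc0 : 0 < c)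
    (hc : ∀ i, c ≤ mu p (E i)) : ∀ᵐ ω ∂mu p, ∃ i, ω ∈ E i := by
  have hlim : Filter.Tendsto (fun M : ℕ => (1 - c) ^ M) Filter.atTop (nhds 0) :=
    ENNReal.tendsto_pow_atTop_nhds_zero_of_lt_one (ENNReal.sub_lt_self one_ne_top one_ne_zero hc0.ne')
  refine le_antisymm (ge_of_tendsto' hlim fun M => ?_) zero_le
  refine le_trans (measure_mono ?_) (mu_iInter_compl_le h0 h1 hD hE hc M)
  intro ω hω
  simp only [Set.mem_iInter, Set.mem_compl_iff]
  exact fun i _ hi => hω ⟨i, hi⟩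

/-- For a stationary family of events, each a decreasing limit of events depending on disjoint
sets of edges along arithmetic progressions, almost surely one of them occurs as soon as they
have positive probability. -/
lemma ae_exists_of_stationary (h0 : 0 ≤ p) (h1 : p ≤ 1) {D : ℕ → ℕ → Set Edge}
    (hD : ∀ N, Pairwise fun i j => Disjoint (D (i * (N + 1)) N) (D (j * (N + 1)) N))
    {E : ℕ → ℕ → Set Config} (hE : ∀ j N, MeasurableSet[edgeSigma (D j N)] (E j N))
    (hanti : ∀ j, Antitone (E j)) (hstat : ∀ j N, mu p (E j N) = mu p (E 0 N))
    (hpos : 0 < mu p (⋂ N, E 0 N)) : ∀ᵐ ω ∂mu p, ∃ j, ∀ N, ω ∈ E j N := by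
  have := isProbabilityMeasure_mu h0 h1
  set c := mu p (⋂ N, E 0 N) with hc
  have hmeas : ∀ j N, MeasurableSet (E j N) := fun j N => edgeSigma_le _ _ (hE j N)
  have hlim : ∀ j, Filter.Tendsto (fun N => mu p (E j N)) Filter.atTop
      (nhds (mu p (⋂ N, E j N))) := fun j =>
    tendsto_measure_iInter_atTop (fun N => (hmeas j N).nullMeasurableSet) (hanti j)
      ⟨0, measure_ne_top _ _⟩
  have hcj : ∀ j, mu p (⋂ N, E j N) = c := fun j =>
    tendsto_nhds_unique (hlim j) (by simpa only [hstat j] using hlim 0)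
  have hbound : ∀ M N : ℕ, mu p {ω | ¬ ∃ j, ∀ N, ω ∈ E j N}
      ≤ (1 - c) ^ M + M * (mu p (E 0 N) - c) := by
    intro M N
    have hsub : {ω | ¬ ∃ j, ∀ N, ω ∈ E j N} ⊆ (⋂ i < M, (E (i * (N + 1)) N)ᶜ) ∪
        ⋃ i ∈ Finset.range M, (E (i * (N + 1)) N \ ⋂ K, E (i * (N + 1)) K) := by
      intro ω hω
      by_cases h : ∃ i < M, ω ∈ E (i * (N + 1)) N
      · obtain ⟨i, hi, hωi⟩ := h
        refine Or.inr (Set.mem_biUnion (Finset.mem_coe.2 (Finset.mem_range.2 hi)) ⟨hωi, ?_⟩)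
        exact fun h => hω ⟨_, Set.mem_iInter.1 h⟩
      · refine Or.inl ?_
        simp only [Set.mem_iInter, Set.mem_compl_iff]
        exact fun i hi hωi => h ⟨i, hi, hωi⟩
    refine (measure_mono hsub).trans ((measure_union_le _ _).trans (add_le_add ?_ ?_))
    · refine mu_iInter_compl_le h0 h1 (hD N) (fun i => hE _ N) (fun i => ?_) M
      rw [hstat]
      exact measure_mono (Set.iInter_subset _ N)
    · refine (measure_biUnion_finset_le _ _).trans ?_
      have : ∀ i ∈ Finset.range M, mu p (E (i * (N + 1)) N \ ⋂ K, E (i * (N + 1)) K)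
          = mu p (E 0 N) - c := fun i _ => by
        rw [measure_sdiff (Set.iInter_subset _ N)
          (MeasurableSet.iInter fun K => hmeas _ K).nullMeasurableSet (measure_ne_top _ _),
          hstat, hcj]
      rw [Finset.sum_congr rfl this]
      simp
  have hbound' : ∀ M : ℕ, mu p {ω | ¬ ∃ j, ∀ N, ω ∈ E j N} ≤ (1 - c) ^ M := by
    intro M
    have hz : Filter.Tendsto (fun N => mu p (E 0 N) - c) Filter.atTop (nhds 0) := by
      have := ENNReal.Tendsto.sub (hlim 0) (tendsto_const_nhds (x := c))
        (Or.inl (measure_ne_top _ _))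
      simpa [hcj] using this
    have hz' : Filter.Tendsto (fun N => (1 - c) ^ M + M * (mu p (E 0 N) - c)) Filter.atTop
        (nhds ((1 - c) ^ M + M * 0)) :=
      tendsto_const_nhds.add (ENNReal.Tendsto.const_mul hz (Or.inr (by simp)))
    simpa using ge_of_tendsto' hz' (hbound M)
  have hlim0 : Filter.Tendsto (fun M : ℕ => (1 - c) ^ M) Filter.atTop (nhds 0) :=
    ENNReal.tendsto_pow_atTop_nhds_zero_of_lt_one
      (ENNReal.sub_lt_self one_ne_top one_ne_zero hpos.ne')
  exact le_antisymm (ge_of_tendsto' hlim0 hbound') zero_le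

end IndependentTrials

section Reach

/-- A directed step of the random-orientation model between two vertices of `S`. -/
def stepIn (η : Config) (S : Set (ℤ × ℤ)) (a b : ℤ × ℤ) : Prop := gStep η a b ∧ a ∈ S ∧ b ∈ S

/-- There is a directed path from `a` to `b` inside `S` in the random-orientation model. -/
def Reach (η : Config) (S : Set (ℤ × ℤ)) : ℤ × ℤ → ℤ × ℤ → Prop :=
  Relation.ReflTransGen (stepIn η S)

/-- The edges with both endpoints in `S`. -/
def edgesIn (S : Set (ℤ × ℤ)) : Set Edge := {e | eSrc e ∈ S ∧ eDst e ∈ S}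

lemma gStep_iff {η : Config} {u v : ℤ × ℤ} : gStep η u v ↔
    (v = (u.1 + 1, u.2) ∧ η (u, false) = true) ∨ (v = (u.1, u.2 + 1) ∧ η (u, true) = true) ∨
    (u = (v.1 + 1, v.2) ∧ η (v, false) = false) ∨ (u = (v.1, v.2 + 1) ∧ η (v, true) = false) := by
  constructor
  · rintro ⟨⟨x, b⟩, ⟨rfl, rfl, h⟩ | ⟨rfl, rfl, h⟩⟩ <;> cases b <;> simp_all [eSrc, eDst]
  · rintro (⟨rfl, h⟩ | ⟨rfl, h⟩ | ⟨rfl, h⟩ | ⟨rfl, h⟩)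
    · exact ⟨(u, false), Or.inl ⟨rfl, rfl, h⟩⟩
    · exact ⟨(u, true), Or.inl ⟨rfl, rfl, h⟩⟩
    · exact ⟨(v, false), Or.inr ⟨rfl, rfl, h⟩⟩
    · exact ⟨(v, true), Or.inr ⟨rfl, rfl, h⟩⟩

lemma Reach.mono {η : Config} {S T : Set (ℤ × ℤ)} (hST : S ⊆ T) {a b : ℤ × ℤ}
    (h : Reach η S a b) : Reach η T a b :=
  Relation.ReflTransGen.mono (fun _ _ h => ⟨h.1, hST h.2.1, hST h.2.2⟩) _ _ h

lemma measurableSet_stepIn (S : Set (ℤ × ℤ)) (a b : ℤ × ℤ) :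
    MeasurableSet[edgeSigma (edgesIn S)] {η | stepIn η S a b} := by
  by_cases hab : a ∈ S ∧ b ∈ S
  · have : {η | stepIn η S a b} = ⋃ e : Edge,
        {η : Config | (eSrc e = a ∧ eDst e = b ∧ η e = true) ∨
          (eSrc e = b ∧ eDst e = a ∧ η e = false)} := by
      ext η
      simp [stepIn, gStep, hab]
    rw [this]
    refine MeasurableSet.iUnion fun e => ?_
    rw [Set.ofPred_or]
    refine MeasurableSet.union ?_ ?_
    · by_cases h : eSrc e = a ∧ eDst e = b
      · convert measurableSet_edgeSigma_eq (D := edgesIn S) (e := e) ?_ true using 2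
        · ext η; simp [h]
        · simp [edgesIn, h, hab]
      · convert @MeasurableSet.empty Config (edgeSigma (edgesIn S)) using 1
        ext η; simp only [Set.mem_ofPred_eq, Set.mem_empty_iff_false]; tauto
    · by_cases h : eSrc e = b ∧ eDst e = a
      · convert measurableSet_edgeSigma_eq (D := edgesIn S) (e := e) ?_ false using 2
        · ext η; simp [h]
        · simp [edgesIn, h, hab]
      · convert @MeasurableSet.empty Config (edgeSigma (edgesIn S)) using 1
        ext η; simp only [Set.mem_ofPred_eq, Set.mem_empty_iff_false]; tauto
  · convert @MeasurableSet.empty Config (edgeSigma (edgesIn S)) using 1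
    ext η; simp only [stepIn, Set.mem_ofPred_eq, Set.mem_empty_iff_false]; tauto

/-- Reachability in a prescribed number of steps. -/
def reachSteps {α : Type*} (r : α → α → Prop) (a : α) : ℕ → α → Prop
  | 0, b => a = b
  | m + 1, b => ∃ c, reachSteps r a m c ∧ r c b

lemma reflTransGen_iff_reachSteps {α : Type*} {r : α → α → Prop} {a b : α} :
    Relation.ReflTransGen r a b ↔ ∃ m, reachSteps r a m b := by
  constructor
  · intro h
    induction h with
    | refl => exact ⟨0, rfl⟩
    | tail _ hbc ih =>
      obtain ⟨m, hm⟩ := ih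
      exact ⟨m + 1, _, hm, hbc⟩
  · rintro ⟨m, hm⟩
    induction m generalizing b with
    | zero => exact hm ▸ .refl
    | succ m ih =>
      obtain ⟨c, hc, hcb⟩ := hm
      exact (ih hc).tail hcb

lemma measurableSet_reach (S : Set (ℤ × ℤ)) (a b : ℤ × ℤ) :
    MeasurableSet[edgeSigma (edgesIn S)] {η | Reach η S a b} := by
  simp only [Reach, reflTransGen_iff_reachSteps, Set.ofPred_exists]
  refine MeasurableSet.iUnion fun m => ?_
  induction m generalizing b with
  | zero => exact MeasurableSet.const _
  | succ m ih =>
    simp only [reachSteps, Set.ofPred_exists, Set.ofPred_and]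
    exact MeasurableSet.iUnion fun c => MeasurableSet.inter (ih c) (measurableSet_stepIn S c b)

lemma exists_path {α : Type*} {r : α → α → Prop} {a b : α} (h : Relation.ReflTransGen r a b) :
    ∃ (γ : ℕ → α) (L : ℕ), γ 0 = a ∧ γ L = b ∧ ∀ i < L, r (γ i) (γ (i + 1)) := by
  induction h using Relation.ReflTransGen.head_induction_on with
  | refl => exact ⟨fun _ => b, 0, rfl, rfl, by simp⟩
  | @head a c hac _ ih =>
    obtain ⟨γ, L, h0, hL, hs⟩ := ih
    refine ⟨fun i => if i = 0 then a else γ (i - 1), L + 1, by simp, by simpa using hL, ?_⟩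
    intro i hi
    rcases Nat.eq_zero_or_pos i with rfl | hpos
    · simpa [h0] using hac
    · have := hs (i - 1) (by omega)
      rw [Nat.sub_add_cancel hpos] at this
      simpa [hpos.ne'] using this

lemma reflTransGen_of_path {α : Type*} {r : α → α → Prop} {γ : ℕ → α} {L : ℕ}
    (h : ∀ i < L, r (γ i) (γ (i + 1))) {i j : ℕ} (hij : i ≤ j) (hj : j ≤ L) :
    Relation.ReflTransGen r (γ i) (γ j) := by
  induction j, hij using Nat.le_induction with
  | base => exact .refl
  | succ j _ ih => exact (ih (by omega)).tail (h j (by omega))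

/-- The part of the NE quadrant with corner `v` within horizontal distance `N` of `v`. -/
def quadStrip (v : ℤ × ℤ) (N : ℕ) : Set (ℤ × ℤ) :=
  {w | v.1 ≤ w.1 ∧ w.1 ≤ v.1 + N ∧ v.2 ≤ w.2}

/-- There is a directed path from `v` to the column at distance `N` to its right, inside the
NE quadrant with corner `v`. -/
def Cross (η : Config) (v : ℤ × ℤ) (N : ℕ) : Prop :=
  ∃ w : ℤ × ℤ, w.1 = v.1 + N ∧ Reach η (quadStrip v N) v w

lemma measurableSet_cross (v : ℤ × ℤ) (N : ℕ) :
    MeasurableSet[edgeSigma (edgesIn (quadStrip v N))] {η | Cross η v N} := by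
  simp only [Cross, Set.ofPred_exists, Set.ofPred_and]
  exact MeasurableSet.iUnion fun w =>
    MeasurableSet.inter (MeasurableSet.const _) (measurableSet_reach _ v w)

/-- Translation of edges. -/
def shiftEdge (u : ℤ × ℤ) (e : Edge) : Edge := (e.1 + u, e.2)

lemma shiftEdge_injective (u : ℤ × ℤ) : Function.Injective (shiftEdge u) := by
  rintro ⟨a, b⟩ ⟨a', b'⟩ h
  simpa [shiftEdge] using h

lemma gStep_shift {η : Config} {u a b : ℤ × ℤ} :
    gStep (fun e => η (shiftEdge u e)) a b ↔ gStep η (a + u) (b + u) := by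
  obtain ⟨a1, a2⟩ := a
  obtain ⟨b1, b2⟩ := b
  obtain ⟨u1, u2⟩ := u
  simp only [gStep_iff, shiftEdge, Prod.mk_add_mk, Prod.mk.injEq]
  have h1 : ∀ x y z : ℤ, x + z = y + z + 1 ↔ x = y + 1 := by intros; omega
  have h2 : ∀ x y z : ℤ, x + z = y + z ↔ x = y := by intros; omega
  simp only [h1, h2]

lemma cross_shift {η : Config} {u v : ℤ × ℤ} {N : ℕ} :
    Cross (fun e => η (shiftEdge u e)) v N ↔ Cross η (v + u) N := by
  constructor
  · rintro ⟨w, hw, h⟩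
    refine ⟨w + u, by simp [hw]; ring, Relation.ReflTransGen.lift (· + u) ?_ _ _ h⟩
    rintro a b ⟨hab, ha, hb⟩
    refine ⟨gStep_shift.1 hab, ?_, ?_⟩ <;> simp_all [quadStrip] <;> omega
  · rintro ⟨w, hw, h⟩
    refine ⟨w - u, by simp [hw]; ring, ?_⟩
    have := Relation.ReflTransGen.lift (p := stepIn (fun e => η (shiftEdge u e)) (quadStrip v N))
      (· - u) ?_ _ _ h
    · simpa [Reach, Function.onFun] using this
    rintro a b ⟨hab, ha, hb⟩
    refine ⟨gStep_shift.2 (by simpa using hab), ?_, ?_⟩ <;> simp_all [quadStrip] <;> omega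

lemma mu_shift {q : ℝ} (h0 : 0 ≤ q) (h1 : q ≤ 1) (u : ℤ × ℤ) {E : Set Config}
    (hE : MeasurableSet E) : mu q ((fun (η : Config) e => η (shiftEdge u e)) ⁻¹' E) = mu q E := by
  conv_rhs => rw [← map_reindex_mu h0 h1 (shiftEdge_injective u)]
  rw [Measure.map_apply (by fun_prop) hE]

end Reach

section Planarity

/-- Two vertices of `ℤ²` are adjacent. -/
def Adj (a b : ℤ × ℤ) : Prop :=
  (a.2 = b.2 ∧ (b.1 = a.1 + 1 ∨ a.1 = b.1 + 1)) ∨ (a.1 = b.1 ∧ (b.2 = a.2 + 1 ∨ a.2 = b.2 + 1))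

lemma gStep.adj {η : Config} {a b : ℤ × ℤ} (h : gStep η a b) : Adj a b := by
  rcases gStep_iff.1 h with ⟨rfl, -⟩ | ⟨rfl, -⟩ | ⟨rfl, -⟩ | ⟨rfl, -⟩ <;> simp [Adj]

/-- Indicator that the step from `a` to `b` crosses the vertical ray starting from
`v + (1/2, 0)` upwards. -/
def crossing (v a b : ℤ × ℤ) : ZMod 2 :=
  if a.2 = b.2 ∧ v.2 < a.2 ∧ ((a.1 = v.1 ∧ b.1 = v.1 + 1) ∨ (b.1 = v.1 ∧ a.1 = v.1 + 1))
    then 1 else 0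

/-- Indicator that `a` lies strictly above `v` in the same column. -/
def aboveInd (v a : ℤ × ℤ) : ZMod 2 := if a.1 = v.1 ∧ v.2 < a.2 then 1 else 0

/-- Indicator that `a` is not to the right of `v`. -/
def leftInd (v a : ℤ × ℤ) : ZMod 2 := if a.1 ≤ v.1 then 1 else 0

/-- The parity of the number of crossings of the path `β 0, …, β L` with the vertical ray from
`v + (1/2, 0)` upwards. -/
def crossParity (β : ℕ → ℤ × ℤ) (L : ℕ) (v : ℤ × ℤ) : ZMod 2 :=
  ∑ i ∈ Finset.range L, crossing v (β i) (β (i + 1))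

lemma crossing_right {v a b : ℤ × ℤ} (hab : Adj a b) (ha : a ≠ (v.1 + 1, v.2))
    (hb : b ≠ (v.1 + 1, v.2)) :
    crossing v a b + crossing (v.1 + 1, v.2) a b
      = aboveInd (v.1 + 1, v.2) a + aboveInd (v.1 + 1, v.2) b := by
  obtain ⟨a1, a2⟩ := a
  obtain ⟨b1, b2⟩ := b
  obtain ⟨v1, v2⟩ := v
  simp only [crossing, aboveInd, Adj, ne_eq, Prod.mk.injEq] at *
  split_ifs <;> first | rfl | (exfalso; omega)

lemma crossing_up {v a b : ℤ × ℤ} (ha : a ≠ (v.1, v.2 + 1)) (hb : b ≠ (v.1, v.2 + 1)) :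
    crossing v a b = crossing (v.1, v.2 + 1) a b := by
  obtain ⟨a1, a2⟩ := a
  obtain ⟨b1, b2⟩ := b
  obtain ⟨v1, v2⟩ := v
  simp only [crossing, ne_eq, Prod.mk.injEq] at *
  split_ifs <;> first | rfl | (exfalso; omega)

lemma crossing_low {v a b : ℤ × ℤ} (hab : Adj a b) (h : a.2 = b.2 → v.2 < a.2) :
    crossing v a b = leftInd v a + leftInd v b := by
  obtain ⟨a1, a2⟩ := a
  obtain ⟨b1, b2⟩ := b
  obtain ⟨v1, v2⟩ := v
  simp only [crossing, leftInd, Adj] at *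
  split_ifs <;> first | rfl | (exfalso; omega)

lemma sum_range_add_succ_zmod_two (f : ℕ → ZMod 2) (L : ℕ) :
    ∑ i ∈ Finset.range L, (f i + f (i + 1)) = f 0 + f L := by
  induction L with
  | zero => simp [CharTwo.add_self_eq_zero]
  | succ L ih =>
    rw [Finset.sum_range_succ, ih, add_assoc, ← add_assoc (f L), CharTwo.add_self_eq_zero, zero_add]

lemma crossParity_right {β : ℕ → ℤ × ℤ} {L : ℕ} {v : ℤ × ℤ}
    (hβ : ∀ i < L, Adj (β i) (β (i + 1))) (hv : ∀ i ≤ L, β i ≠ (v.1 + 1, v.2))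
    (h0 : aboveInd (v.1 + 1, v.2) (β 0) = 0) (hL : aboveInd (v.1 + 1, v.2) (β L) = 0) :
    crossParity β L v = crossParity β L (v.1 + 1, v.2) := by
  rw [← CharTwo.add_eq_zero, crossParity, crossParity, ← Finset.sum_add_distrib,
    Finset.sum_congr rfl fun i hi => ?_, sum_range_add_succ_zmod_two
      (fun i => aboveInd (v.1 + 1, v.2) (β i)), h0, hL, add_zero]
  have hi' := Finset.mem_range.1 hi
  exact crossing_right (hβ i hi') (hv i hi'.le) (hv (i + 1) hi')

lemma crossParity_up {β : ℕ → ℤ × ℤ} {L : ℕ} {v : ℤ × ℤ}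
    (hv : ∀ i ≤ L, β i ≠ (v.1, v.2 + 1)) :
    crossParity β L v = crossParity β L (v.1, v.2 + 1) := by
  refine Finset.sum_congr rfl fun i hi => ?_
  have hi' := Finset.mem_range.1 hi
  exact crossing_up (hv i hi'.le) (hv (i + 1) hi')

/-- The L-shaped region containing the shielding path from `(j, 0)`. -/
def shield (n j k : ℕ) : Set (ℤ × ℤ) :=
  {v | (v.1 = j ∧ 0 ≤ v.2) ∨ ((j : ℤ) ≤ v.1 ∧ v.1 ≤ k ∧ (n : ℤ) ≤ v.2)}

/-- The strip `0 ≤ x ≤ k`, `0 ≤ y` without the box of side `n` in its lower right corner. -/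
def avoidStrip (n k : ℕ) : Set (ℤ × ℤ) :=
  {v | 0 ≤ v.1 ∧ v.1 ≤ k ∧ 0 ≤ v.2 ∧ ¬ ((k : ℤ) - n < v.1 ∧ v.2 < n)}

lemma crossParity_low {n j k : ℕ} {β : ℕ → ℤ × ℤ} {L : ℕ}
    (hβ : ∀ i < L, Adj (β i) (β (i + 1)) ∧ β i ∈ shield n j k ∧ β (i + 1) ∈ shield n j k)
    (h0 : β 0 = ((j : ℤ), 0)) (hL : (β L).1 = k) {v : ℤ × ℤ} (hj : (j : ℤ) ≤ v.1) (hk : v.1 < k)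
    (hn : v.2 < n) : crossParity β L v = 1 := by
  rw [crossParity, Finset.sum_congr rfl fun i hi => ?_, sum_range_add_succ_zmod_two
    (fun i => leftInd v (β i))]
  · simp [leftInd, h0, hL, hj, hk]
  · obtain ⟨hadj, h1, h2⟩ := hβ i (Finset.mem_range.1 hi)
    refine crossing_low hadj fun h => ?_
    simp only [shield, Set.mem_ofPred_eq, Adj] at *
    omega

/-- A path crossing the strip `0 ≤ x ≤ k` can be rerouted along a shielding path so that it avoids
the box of side `n` in the lower right corner. -/
lemma exists_reach_avoidStrip {η : Config} {n j k : ℕ} (hn : 0 < n) (hk : j + n ≤ k)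
    (hα : Cross η (0, 0) k) {w : ℤ × ℤ} (hw : w.1 = k) (hβ : Reach η (shield n j k) (j, 0) w) :
    ∃ z : ℤ × ℤ, z.1 = k ∧ Reach η (avoidStrip n k) (0, 0) z := by
  obtain ⟨β, L, hβ0, hβL, hβs⟩ := exists_path hβ
  obtain ⟨u, hu, hα⟩ := hα
  have hsub : shield n j k ⊆ avoidStrip n k := by
    intro v hv
    simp only [shield, avoidStrip, Set.mem_ofPred_eq] at *
    omega
  have hβadj : ∀ i < L, Adj (β i) (β (i + 1)) := fun i hi => (hβs i hi).1.adj
  have hβL' : (β L).1 = k := by rw [hβL, hw]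
  have hL : 0 < L := by
    rcases Nat.eq_zero_or_pos L with rfl | h
    · rw [hβ0] at hβL'
      simp at hβL'
      omega
    · exact h
  have hβmem : ∀ i ≤ L, β i ∈ shield n j k := by
    intro i hi
    rcases hi.eq_or_lt with rfl | h
    · have := (hβs (i - 1) (by omega)).2.2
      rwa [Nat.sub_add_cancel hL] at this
    · exact (hβs i h).2.1
  have hfollow : ∀ i ≤ L, Reach η (avoidStrip n k) (0, 0) (β i) →
      ∃ z : ℤ × ℤ, z.1 = k ∧ Reach η (avoidStrip n k) (0, 0) z := fun i hi h =>
    ⟨β L, hβL', h.trans (Reach.mono hsub (reflTransGen_of_path hβs hi le_rfl))⟩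
  have hlow : ∀ v : ℤ × ℤ, crossParity β L v = 0 → v.1 < k → (j : ℤ) ≤ v.1 → (n : ℤ) ≤ v.2 := by
    intro v hv h1 h2
    by_contra h3
    rw [crossParity_low (fun i hi => ⟨hβadj i hi, (hβs i hi).2⟩) hβ0 hβL' h2 h1 (not_le.1 h3)] at hv
    exact one_ne_zero hv
  have habove : ∀ v : ℤ × ℤ, 0 ≤ v.2 → v.1 < k → aboveInd v (β 0) = 0 ∧ aboveInd v (β L) = 0 := by
    intro v h1 h2
    simp only [aboveInd, hβ0, hβL']
    refine ⟨if_neg ?_, if_neg ?_⟩ <;> omega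
  have key : ∀ b, Reach η (quadStrip (0, 0) k) (0, 0) b →
      (∃ z : ℤ × ℤ, z.1 = k ∧ Reach η (avoidStrip n k) (0, 0) z) ∨
      (Reach η (avoidStrip n k) (0, 0) b ∧ (∀ i ≤ L, β i ≠ b) ∧ crossParity β L b = 0 ∧
        b.1 < k) := by
    intro b hb
    induction hb with
    | refl =>
      by_cases h : ∃ i ≤ L, β i = (0, 0)
      · obtain ⟨i, hi, h⟩ := h
        exact Or.inl (hfollow i hi (h ▸ .refl))
      · push Not at h
        refine Or.inr ⟨.refl, h, ?_, by simp; omega⟩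
        refine Finset.sum_eq_zero fun i hi => if_neg ?_
        have hi := Finset.mem_range.1 hi
        have h1 := hβmem i hi.le
        have h2 := hβmem (i + 1) hi
        have hj : j ≠ 0 := by
          rintro rfl
          exact h 0 (Nat.zero_le _) hβ0
        simp only [shield, Set.mem_ofPred_eq] at *
        omega
    | @tail b c _ hbc ih =>
      rcases ih with h | ⟨hreach, hoff, hpar, hbk⟩
      · exact Or.inl h
      obtain ⟨hstep, hbS, hcS⟩ := hbc
      have hb := hlow b hpar hbk
      simp only [quadStrip, Set.mem_ofPred_eq, zero_add] at hbS hcS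
      have hadj := hstep.adj
      have hbV : b ∈ avoidStrip n k := by
        simp only [avoidStrip, Set.mem_ofPred_eq]
        omega
      have hgo : c ∈ avoidStrip n k → Reach η (avoidStrip n k) (0, 0) c := fun hc =>
        hreach.tail ⟨hstep, hbV, hc⟩
      by_cases h : ∃ i ≤ L, β i = c
      · obtain ⟨i, hi, rfl⟩ := h
        exact Or.inl (hfollow i hi (hgo (hsub (hβmem i hi))))
      push Not at h
      by_cases hck : c.1 = k
      · refine Or.inl ⟨c, hck, hgo ?_⟩
        simp only [avoidStrip, Set.mem_ofPred_eq, Adj] at *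
        omega
      have hck' : c.1 < k := by omega
      have hpar' : crossParity β L c = 0 := by
        rw [← hpar]
        rcases gStep_iff.1 hstep with ⟨hc, -⟩ | ⟨hc, -⟩ | ⟨hc, -⟩ | ⟨hc, -⟩
        · have := habove c hcS.2.2 hck'
          rw [hc] at this h ⊢
          exact (crossParity_right hβadj h this.1 this.2).symm
        · rw [hc] at h ⊢
          exact (crossParity_up h).symm
        · have := habove b hbS.2.2 hbk
          rw [hc] at this hoff ⊢
          exact crossParity_right hβadj hoff this.1 this.2
        · rw [hc] at hoff ⊢
          exact crossParity_up hoff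
      have hc := hlow c hpar' hck'
      refine Or.inr ⟨hgo ?_, h, hpar', hck'⟩
      simp only [avoidStrip, Set.mem_ofPred_eq]
      omega
  rcases key u hα with h | h
  · exact h
  · have := h.2.2.2
    simp only [zero_add] at hu
    omega

end Planarity

section Percolation

variable {q : ℝ}

lemma cross_of_percolates_of_blocked {η : Config} (hperc : percolates (gStep η) NEquad) {M h : ℕ}
    (hrow : ∀ x ∈ Finset.Icc (0 : ℤ) M, η ((x, (h : ℤ)), true) = false) : Cross η (0, 0) M := by
  obtain ⟨γ, hγ0, hinj, hstep, hmem⟩ := hperc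
  have hex : ∃ i, (M : ℤ) ≤ (γ i).1 := by
    by_contra hcon
    push Not at hcon
    have hy : ∀ i, (γ i).2 ≤ h := by
      intro i
      induction i with
      | zero => simp [hγ0]
      | succ i ih =>
        by_contra hlt
        have hm := hmem i
        rcases gStep_iff.1 (hstep i) with ⟨hc, -⟩ | ⟨hc, hb⟩ | ⟨hc, -⟩ | ⟨hc, -⟩
        · rw [hc] at hlt; exact hlt ih
        · have h2 : (γ i).2 = h := by
            rw [hc] at hlt
            simp only at hlt
            omega
          have := hrow (γ i).1 (Finset.mem_Icc.2 ⟨hm.1, (hcon i).le⟩)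
          rw [← h2, Prod.mk.eta, hb] at this
          exact Bool.noConfusion this
        · rw [hc] at ih; exact hlt ih
        · rw [hc] at ih
          simp only at ih
          omega
    refine Set.infinite_range_of_injective hinj
      (((Set.finite_Icc (0 : ℤ) M).prod (Set.finite_Icc (0 : ℤ) h)).subset ?_)
    rintro _ ⟨i, rfl⟩
    exact ⟨⟨(hmem i).1, (hcon i).le⟩, ⟨(hmem i).2, hy i⟩⟩
  classical
  set T := Nat.find hex with hT
  have hTspec : (M : ℤ) ≤ (γ T).1 := Nat.find_spec hex
  have hbefore : ∀ i < T, (γ i).1 < M := fun i hi => not_le.1 (Nat.find_min hex hi)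
  have hTeq : (γ T).1 = M := by
    rcases Nat.eq_zero_or_pos T with h0 | hpos
    · rw [h0, hγ0] at hTspec ⊢
      simp only at hTspec ⊢
      omega
    · have h1 := hbefore (T - 1) (by omega)
      have h2 := (hstep (T - 1)).adj
      rw [Nat.sub_add_cancel hpos] at h2
      simp only [Adj] at h2
      omega
  refine ⟨γ T, by simpa using hTeq, ?_⟩
  have hin : ∀ i ≤ T, γ i ∈ quadStrip (0, 0) M := by
    intro i hi
    refine ⟨(hmem i).1, ?_, (hmem i).2⟩
    rcases hi.eq_or_lt with rfl | h
    · simp [hTeq]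
    · simpa using (hbefore i h).le
  have := reflTransGen_of_path (r := stepIn η (quadStrip (0, 0) M)) (γ := γ) (L := T)
    (fun i hi => ⟨hstep i, hin i hi.le, hin (i + 1) hi⟩) (Nat.zero_le T) le_rfl
  rwa [hγ0] at this

lemma cross_of_all_true {η : Config} (hη : ∀ e, η e = true) (M : ℕ) : Cross η (0, 0) M := by
  refine ⟨((M : ℤ), 0), by simp, ?_⟩
  have := reflTransGen_of_path (r := stepIn η (quadStrip (0, 0) M)) (γ := fun i => ((i : ℤ), 0))
    (L := M) (fun i hi => ⟨gStep_iff.2 (Or.inl ⟨by simp, hη _⟩), ?_, ?_⟩) (Nat.zero_le M) le_rfl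
  · simpa [Reach] using this
  · simp [quadStrip]; omega
  · simp [quadStrip]; omega

lemma ae_cross_of_percolates (h0 : 0 ≤ q) (h1 : q ≤ 1) :
    ∀ᵐ η ∂mu q, percolates (gStep η) NEquad → ∀ M, Cross η (0, 0) M := by
  rcases h1.eq_or_lt with rfl | hq
  · filter_upwards [ae_all_eq (p := 1) h0 h1 (b := true) (by simp [bern_true])] with η hη _ M
    exact cross_of_all_true hη M
  · have hrow : ∀ M : ℕ, ∀ᵐ η ∂mu q, ∃ h : ℕ,
        η ∈ {η : Config | ∀ x ∈ Finset.Icc (0 : ℤ) M, η ((x, (h : ℤ)), true) = false} := by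
      intro M
      have hcard : ∀ h : ℕ,
          mu q {η : Config | ∀ x ∈ Finset.Icc (0 : ℤ) M, η ((x, (h : ℤ)), true) = false}
            = bern q {false} ^ (Finset.Icc (0 : ℤ) M).card := by
        intro h
        have := mu_pi h0 h1 ((Finset.Icc (0 : ℤ) M).image fun x => ((x, (h : ℤ)), true)) false
        rw [Finset.card_image_of_injective _ (fun x y hxy => by simpa using hxy)] at this
        rw [← this]
        congr 1
        ext η
        simp only [Set.mem_ofPred_eq, Finset.forall_mem_image]
      refine ae_exists_of_independent h0 h1 (D := fun h : ℕ => {e | e.1.2 = h}) ?_ ?_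
        (c := bern q {false} ^ (Finset.Icc (0 : ℤ) M).card) ?_ (fun h => (hcard h).ge)
      · intro i j hij
        refine Set.disjoint_left.2 fun e he he' => hij ?_
        simp only [Set.mem_ofPred_eq] at he he'
        omega
      · intro h
        simp only [Set.ofPred_forall]
        exact MeasurableSet.iInter fun x => MeasurableSet.iInter fun _ =>
          measurableSet_edgeSigma_eq (by simp) false
      · rw [bern_false]
        exact ENNReal.pow_pos (ENNReal.ofReal_pos.2 (by linarith)) _
    filter_upwards [ae_all_iff.2 hrow] with η hη hperc M
    obtain ⟨h, hh⟩ := hη M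
    exact cross_of_percolates_of_blocked hperc hh

lemma pos_of_thetaNE_pos (h0 : 0 ≤ q) (hθ : 0 < thetaNE q) : 0 < q := by
  rcases h0.eq_or_lt with rfl | h
  · exfalso
    refine hθ.ne' (measure_mono_null (t := {η : Config | ¬ ∀ e, η e = false}) ?_
      (ae_all_eq le_rfl zero_le_one (by simp [bern_false])))
    rintro η ⟨γ, hγ0, -, hstep, hmem⟩ hη
    have h1 := hstep 0
    have hm := hmem 1
    simp only [gStep_iff, hγ0, hη, zero_add, NEquad, Set.mem_ofPred_eq] at h1 hm
    rcases h1 with ⟨-, h⟩ | ⟨-, h⟩ | ⟨h, -⟩ | ⟨h, -⟩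
    · exact Bool.noConfusion h
    · exact Bool.noConfusion h
    · simp only [Prod.mk.injEq] at h; omega
    · simp only [Prod.mk.injEq] at h; omega
  · exact h

/-- The vertical path from `(j, 0)` to `(j, n)` is directed upwards, and `(j, n)` is connected to
the columns at distance at most `N` to its right within its NE quadrant. -/
def shieldEvent (n j N : ℕ) : Set Config :=
  {η | (∀ i ∈ Finset.range n, η (((j : ℤ), (i : ℤ)), true) = true) ∧
    ∀ M ≤ N, Cross η ((j : ℤ), (n : ℤ)) M}

lemma measurableSet_shieldEvent (n j N : ℕ) :
    MeasurableSet[edgeSigma {e | (j : ℤ) ≤ e.1.1 ∧ e.1.1 ≤ j + N}] (shieldEvent n j N) := by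
  simp only [shieldEvent, Set.ofPred_and, Set.ofPred_forall]
  refine MeasurableSet.inter
    (MeasurableSet.iInter fun i => MeasurableSet.iInter fun _ =>
      measurableSet_edgeSigma_eq (by simp) true)
    (MeasurableSet.iInter fun M => MeasurableSet.iInter fun hM =>
      edgeSigma_mono ?_ _ (measurableSet_cross _ M))
  rintro e ⟨he, -⟩
  simp only [quadStrip, eSrc, Set.mem_ofPred_eq] at he ⊢
  omega

lemma shieldEvent_eq_preimage (n j N : ℕ) : shieldEvent n j N =
    (fun (η : Config) e => η (shiftEdge ((j : ℤ), 0) e)) ⁻¹' shieldEvent n 0 N := by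
  ext η
  simp only [shieldEvent, Set.mem_ofPred_eq, Set.mem_preimage, cross_shift]
  simp [shiftEdge]

lemma mu_iInter_shieldEvent_pos (h0 : 0 ≤ q) (h1 : q ≤ 1) (hθ : 0 < thetaNE q) (n : ℕ) :
    0 < mu q (⋂ N, shieldEvent n 0 N) := by
  have hq := pos_of_thetaNE_pos h0 hθ
  have hset : (⋂ N, shieldEvent n 0 N) =
      {η : Config | ∀ i ∈ Finset.range n, η (((0 : ℤ), (i : ℤ)), true) = true} ∩
      {η | ∀ M, Cross η ((0 : ℤ), (n : ℤ)) M} := by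
    ext η
    simp only [shieldEvent, Set.mem_iInter, Set.mem_ofPred_eq, Set.mem_inter_iff]
    exact ⟨fun h => ⟨(h 0).1, fun M => (h M).2 M le_rfl⟩, fun h N => ⟨h.1, fun M _ => h.2 M⟩⟩
  have hup : MeasurableSet[edgeSigma {e | e.1.2 < n}]
      {η : Config | ∀ i ∈ Finset.range n, η (((0 : ℤ), (i : ℤ)), true) = true} := by
    simp only [Set.ofPred_forall]
    exact MeasurableSet.iInter fun i => MeasurableSet.iInter fun hi =>
      measurableSet_edgeSigma_eq (by simpa using hi) true
  have hcross : ∀ m : ℤ, MeasurableSet[edgeSigma {e | m ≤ e.1.2}]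
      {η | ∀ M, Cross η ((0 : ℤ), m) M} := by
    intro m
    simp only [Set.ofPred_forall]
    refine MeasurableSet.iInter fun M => edgeSigma_mono ?_ _ (measurableSet_cross _ M)
    rintro e ⟨he, -⟩
    exact he.2.2
  have hshift : mu q {η | ∀ M, Cross η ((0 : ℤ), (n : ℤ)) M}
      = mu q {η | ∀ M, Cross η (0, 0) M} := by
    rw [← mu_shift h0 h1 (0, (n : ℤ)) (edgeSigma_le _ _ (hcross 0))]
    congr 1
    ext η
    simp [cross_shift]
  rw [hset, mu_inter_of_disjoint h0 h1 ?_ hup (hcross n), hshift]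
  · refine ENNReal.mul_pos ?_ ?_
    · have := mu_pi h0 h1 ((Finset.range n).image fun i : ℕ => (((0 : ℤ), (i : ℤ)), true)) true
      rw [bern_true] at this
      have hpos := ENNReal.pow_pos (ENNReal.ofReal_pos.2 hq)
        ((Finset.range n).image fun i : ℕ => (((0 : ℤ), (i : ℤ)), true)).card
      rw [← this] at hpos
      refine (hpos.trans_le (measure_mono ?_)).ne'
      intro η hη i hi
      exact hη _ (Finset.mem_image_of_mem _ hi)
    · exact (hθ.trans_le (measure_mono_ae (ae_cross_of_percolates h0 h1))).ne'
  · refine Set.disjoint_left.2 fun e he he' => ?_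
    simp only [Set.mem_ofPred_eq] at he he'
    omega

lemma ae_exists_shield (h0 : 0 ≤ q) (h1 : q ≤ 1) (hθ : 0 < thetaNE q) (n : ℕ) :
    ∀ᵐ η ∂mu q, ∃ j, ∀ N, η ∈ shieldEvent n j N := by
  refine ae_exists_of_stationary h0 h1 (D := fun j N => {e | (j : ℤ) ≤ e.1.1 ∧ e.1.1 ≤ j + N})
    ?_ (measurableSet_shieldEvent n) ?_ ?_ (mu_iInter_shieldEvent_pos h0 h1 hθ n)
  · intro N i j hij
    refine Set.disjoint_left.2 fun e he he' => hij ?_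
    simp only [Set.mem_ofPred_eq, Nat.cast_mul, Nat.cast_add, Nat.cast_one] at he he'
    have hlt : ∀ a b : ℕ, (a : ℤ) * (N + 1) ≤ b * (N + 1) + N → a ≤ b := by
      intro a b hab
      by_contra hlt
      have : (b : ℤ) + 1 ≤ a := by omega
      nlinarith
    exact le_antisymm (hlt _ _ (he.1.trans he'.2)) (hlt _ _ (he'.1.trans he.2))
  · exact fun j N N' hN η hη => ⟨hη.1, fun M hM => hη.2 M (hM.trans hN)⟩
  · intro j N
    rw [shieldEvent_eq_preimage, mu_shift h0 h1 _ (edgeSigma_le _ _ (measurableSet_shieldEvent n 0 N))]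

lemma reach_shield {η : Config} {n j N : ℕ} (h : η ∈ shieldEvent n j N) :
    ∃ w : ℤ × ℤ, w.1 = ((j + N : ℕ) : ℤ) ∧ Reach η (shield n j (j + N)) ((j : ℤ), 0) w := by
  obtain ⟨hup, hcr⟩ := h
  obtain ⟨w, hw, hr⟩ := hcr N le_rfl
  refine ⟨w, by simpa using hw, Relation.ReflTransGen.trans (b := ((j : ℤ), (n : ℤ))) ?_
    (Reach.mono ?_ hr)⟩
  · have := reflTransGen_of_path (r := stepIn η (shield n j (j + N)))
      (γ := fun i => ((j : ℤ), (i : ℤ))) (L := n)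
      (fun i hi => ⟨gStep_iff.2 (Or.inr (Or.inl ⟨by simp, hup i (Finset.mem_range.2 hi)⟩)), ?_, ?_⟩)
      (Nat.zero_le n) le_rfl
    · simpa using this
    · simp [shield]
    · simp [shield]; omega
  · intro v hv
    simp only [quadStrip, shield, Set.mem_ofPred_eq, Nat.cast_add] at *
    omega

/-- The directed crossing event of the strip `0 ≤ x ≤ k` avoiding the box of side `n` in the lower
right corner. -/
def avoidEvent (n k : ℕ) : Set Config :=
  {η | ∃ z : ℤ × ℤ, z.1 = k ∧ Reach η (avoidStrip n k) (0, 0) z}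

lemma measurableSet_avoidEvent (n k : ℕ) : MeasurableSet (avoidEvent n k) := by
  simp only [avoidEvent, Set.ofPred_exists, Set.ofPred_and]
  exact MeasurableSet.iUnion fun z =>
    MeasurableSet.inter (MeasurableSet.const _) (edgeSigma_le _ _ (measurableSet_reach _ _ z))

lemma ae_eventually_avoidEvent (h0 : 0 ≤ q) (h1 : q ≤ 1) (hθ : 0 < thetaNE q) {n : ℕ}
    (hn : 0 < n) :
    ∀ᵐ η ∂mu q, percolates (gStep η) NEquad → ∃ K, ∀ k ≥ K, η ∈ avoidEvent n k := by
  filter_upwards [ae_cross_of_percolates h0 h1, ae_exists_shield h0 h1 hθ n] with η hc hs hperc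
  obtain ⟨j, hj⟩ := hs
  refine ⟨j + n, fun k hk => ?_⟩
  obtain ⟨N, rfl⟩ := Nat.exists_eq_add_of_le ((Nat.le_add_right j n).trans hk)
  obtain ⟨w, hw, hr⟩ := reach_shield (hj N)
  exact exists_reach_avoidStrip hn hk (hc hperc _) hw hr

end Percolation

section Duality

/-- The edge of `ℤ²` crossed by the dual edge that corresponds to `e` under the reflection
`(a, b) ↦ (k - a, b)`. -/
def dualEdge (k : ℕ) (e : Edge) : Edge :=
  if e.2 then ((k - e.1.1, e.1.2 + 1), false) else ((k - e.1.1, e.1.2), true)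

lemma dualEdge_injective (k : ℕ) : Function.Injective (dualEdge k) := by
  rintro ⟨⟨a, b⟩, c⟩ ⟨⟨a', b'⟩, c'⟩ h
  cases c <;> cases c' <;> simp_all [dualEdge]

lemma hPos_vertical {ω : Config} {a b : ℤ} (hb : 0 ≤ b) :
    hPos ω ((a, b), true) ↔ ω ((a, b), true) = true := by
  have : a ^ 2 + b ^ 2 < a ^ 2 + (b + 1) ^ 2 := by nlinarith
  simp [hPos, eSrc, eDst, normSq, this]

lemma hPos_horizontal {ω : Config} {a b : ℤ} (ha : 0 ≤ a) :
    hPos ω ((a, b), false) ↔ ω ((a, b), false) = true := by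
  have : a ^ 2 + b ^ 2 < (a + 1) ^ 2 + b ^ 2 := by nlinarith
  simp [hPos, eSrc, eDst, normSq, this]

lemma dualStep_of_gStep {ω : Config} {k : ℕ} {u v : ℤ × ℤ} (hu : u.1 ≤ k ∧ 0 ≤ u.2)
    (hv : v.1 ≤ k ∧ 0 ≤ v.2) (h : gStep (fun e => !ω (dualEdge k e)) u v) :
    dualStep ω (k - u.1, u.2) (k - v.1, v.2) := by
  obtain ⟨u1, u2⟩ := u
  obtain ⟨v1, v2⟩ := v
  simp only at hu hv
  simp only [gStep_iff, dualEdge, Prod.mk.injEq, Bool.not_eq_true', Bool.not_eq_false'] at h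
  simp only [dualStep, Prod.mk.injEq]
  rcases h with ⟨⟨rfl, rfl⟩, h⟩ | ⟨⟨rfl, rfl⟩, h⟩ | ⟨⟨rfl, rfl⟩, h⟩ | ⟨⟨rfl, rfl⟩, h⟩
  · refine Or.inr (Or.inl ⟨⟨by ring, rfl⟩, ?_⟩)
    rw [hPos_vertical hv.2, show (k : ℤ) - (u1 + 1) + 1 = k - u1 by ring]
    simpa using h
  · refine Or.inr (Or.inr (Or.inl ⟨⟨rfl, rfl⟩, ?_⟩))
    rw [hPos_horizontal (by omega)]
    simpa using h
  · refine Or.inl ⟨⟨by ring, rfl⟩, ?_⟩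
    rw [hPos_vertical hv.2, show (k : ℤ) - (v1 + 1) + 1 = k - v1 by ring]
    simpa using h
  · refine Or.inr (Or.inr (Or.inr ⟨⟨rfl, rfl⟩, ?_⟩))
    rw [hPos_horizontal (by omega)]
    simpa using h

lemma bplusAvoid_of_avoidEvent {ω : Config} {n k : ℕ} (hk : n ≤ k)
    (h : (fun e => !ω (dualEdge k e)) ∈ avoidEvent n k) : BplusAvoid n k ω := by
  obtain ⟨z, hz, hr⟩ := h
  obtain ⟨γ, L, hγ0, hγL, hs⟩ := exists_path hr
  have hmem : ∀ i ≤ L, γ i ∈ avoidStrip n k := by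
    intro i hi
    cases i with
    | zero =>
      rw [hγ0]
      simp only [avoidStrip, Set.mem_ofPred_eq]
      omega
    | succ i => exact (hs i hi).2.2
  refine ⟨fun i => (k - (γ i).1, (γ i).2), L, by simp [hγ0], by simp [hγL, hz], ?_, ?_⟩
  · intro i hi
    have h1 := (hs i hi).2.1
    have h2 := (hs i hi).2.2
    exact dualStep_of_gStep ⟨h1.2.1, h1.2.2.1⟩ ⟨h2.2.1, h2.2.2.1⟩ (hs i hi).1
  · intro i hi
    have := hmem i hi
    simp only [avoidStrip, dualNE, inBox, Set.mem_ofPred_eq] at *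
    omega

lemma mu_avoidEvent_le {p : ℝ} (h0 : 0 ≤ p) (h1 : p ≤ 1) {n k : ℕ} (hk : n ≤ k) :
    mu (1 - p) (avoidEvent n k) ≤ mu p {ω | BplusAvoid n k ω} := by
  have hm : Measurable (fun (ω : Config) e => !ω (dualEdge k e)) :=
    measurable_pi_lambda _ fun e =>
      (measurable_of_countable (fun b : Bool => !b)).comp (measurable_pi_apply _)
  rw [← map_not_reindex_mu h0 h1 (dualEdge_injective k),
    Measure.map_apply hm (measurableSet_avoidEvent n k)]
  exact measure_mono fun ω hω => bplusAvoid_of_avoidEvent hk hω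

end Duality

lemma measure_eventually_le_liminf {α : Type*} [MeasurableSpace α] (μ : Measure α)
    (s : ℕ → Set α) : μ {x | ∃ K, ∀ k ≥ K, x ∈ s k} ≤ Filter.liminf (fun k => μ (s k)) .atTop := by
  have hmono : Monotone fun K => ⋂ k ≥ K, s k := fun K K' hK =>
    Set.iInter_mono fun k => Set.iInter_mono' fun hk => ⟨hK.trans hk, subset_rfl⟩
  have hset : {x | ∃ K, ∀ k ≥ K, x ∈ s k} = ⋃ K, ⋂ k ≥ K, s k := by
    ext x
    simp
  rw [hset, hmono.measure_iUnion, Filter.liminf_eq_iSup_iInf_of_nat]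
  exact iSup_mono fun K => le_iInf₂ fun k hk => measure_mono (Set.iInter₂_subset k hk)

/-- If `θ = θ_NE(1-p) > 0`, then for any `n > 0`,
`liminf_{x → ∞} P(B⁺_n(x)) ≥ θ`. -/
theorem liminf_BplusAvoid_ge_theta (p : ℝ) (hp0 : 0 ≤ p) (hp1 : p ≤ 1)
    (n : ℕ) (hn : 0 < n) (hθ : 0 < thetaNE (1 - p)) :
    thetaNE (1 - p) ≤
      Filter.liminf (fun k : ℕ => mu p {ω | BplusAvoid n k ω}) Filter.atTop := by
  calc thetaNE (1 - p) ≤ mu (1 - p) {η | ∃ K, ∀ k ≥ K, η ∈ avoidEvent n k} :=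
        measure_mono_ae (ae_eventually_avoidEvent (by linarith) (by linarith) hθ hn)
    _ ≤ Filter.liminf (fun k => mu (1 - p) (avoidEvent n k)) Filter.atTop :=
        measure_eventually_le_liminf _ _
    _ ≤ _ := by
        refine Filter.liminf_le_liminf ?_
        filter_upwards [Filter.eventually_ge_atTop n] with k hk
        exact mu_avoidEvent_le hp0 hp1 hk

end RandomOrientation
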